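/- arXiv:2212.05498 — 2 statements merged into one kernel-verified Lean document; each statement's English description precedes it below -/
import Mathlib

section
/- Let G be a countable graph such that for every vertex v of G, the graph G is a minor of G − v. Then the class of countable graphs with no G-minor has no minor-universal element: there is no countable graph U such that U has no G minor and every countable graph with no G minor is a minor of U. -/
/-- `H` is a minor of `G`: pairwise disjoint nonempty connected branch sets, one for each
vertex of `H`, with a `G`-edge between the branch sets of any two `H`-adjacent vertices. -/
def IsMinor {V : Type*} {W : Type*} (H : SimpleGraph V) (G : SimpleGraph W) : Prop :=
  ∃ B : V → Set W,
    (∀ v : V, (G.induce (B v)).Connected) ∧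
    (∀ u v : V, u ≠ v → Disjoint (B u) (B v)) ∧
    (∀ u v : V, H.Adj u v → ∃ x ∈ B u, ∃ y ∈ B v, G.Adj x y)

/-- The union of connected sets indexed by a connected set, with adjacent indices giving
adjacent sets, is connected. -/
lemma connected_induce_biUnion {V W : Type*} {G : SimpleGraph V} {K : SimpleGraph W}
    {D : V → Set W} (hD : ∀ v, (K.induce (D v)).Connected)
    (hadj : ∀ u v, G.Adj u v → ∃ x ∈ D u, ∃ y ∈ D v, K.Adj x y)
    {S : Set V} (hS : (G.induce S).Connected) :
    (K.induce (⋃ v ∈ S, D v)).Connected := by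
  have mem {v : V} (hv : v ∈ S) {x : W} (hx : x ∈ D v) : x ∈ ⋃ v ∈ S, D v :=
    Set.mem_biUnion hv hx
  have within {v : V} (hv : v ∈ S) {x y : W} (hx : x ∈ D v) (hy : y ∈ D v) :
      (K.induce (⋃ v ∈ S, D v)).Reachable ⟨x, mem hv hx⟩ ⟨y, mem hv hy⟩ :=
    ((hD v).preconnected ⟨x, hx⟩ ⟨y, hy⟩).map
      (SimpleGraph.induceHomOfLE K (Set.subset_biUnion_of_mem hv)).toHom
  have across {v v' : S} (h : (G.induce S).Reachable v v') :
      ∀ x (hx : x ∈ D v) y (hy : y ∈ D v'),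
        (K.induce (⋃ v ∈ S, D v)).Reachable ⟨x, mem v.2 hx⟩ ⟨y, mem v'.2 hy⟩ := by
    rw [SimpleGraph.reachable_iff_reflTransGen] at h
    induction h with
    | refl => exact fun x hx y hy => within v.2 hx hy
    | @tail b c _ hbc ih =>
      intro x hx y hy
      obtain ⟨p, hp, q, hq, hpq⟩ := hadj b c hbc
      have edge : (K.induce (⋃ v ∈ S, D v)).Adj ⟨p, mem b.2 hp⟩ ⟨q, mem c.2 hq⟩ := hpq
      exact ((ih x hx p hp).trans edge.reachable).trans (within c.2 hq hy)
  obtain ⟨v⟩ := hS.nonempty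
  obtain ⟨x⟩ := (hD v).nonempty
  have : Nonempty ↥(⋃ v ∈ S, D v) := ⟨⟨x, mem v.2 x.2⟩⟩
  refine ⟨?_⟩
  rintro ⟨a, ha⟩ ⟨b, hb⟩
  simp only [Set.mem_iUnion] at ha hb
  obtain ⟨v, hv, hav⟩ := ha
  obtain ⟨w, hw, hbw⟩ := hb
  exact across (hS.preconnected ⟨v, hv⟩ ⟨w, hw⟩) a hav b hbw

lemma disjoint_biUnion_of_disjoint {V W : Type*} {D : V → Set W}
    (hD : ∀ u v, u ≠ v → Disjoint (D u) (D v)) {S T : Set V} (h : Disjoint S T) :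
    Disjoint (⋃ v ∈ S, D v) (⋃ v ∈ T, D v) := by
  simp only [Set.disjoint_iUnion_left, Set.disjoint_iUnion_right]
  exact fun u hu v hv => hD _ _ fun e => Set.disjoint_left.1 h hv (e ▸ hu)

lemma exists_adj_biUnion {V W : Type*} {G : SimpleGraph V} {K : SimpleGraph W} {D : V → Set W}
    (hadj : ∀ u v, G.Adj u v → ∃ x ∈ D u, ∃ y ∈ D v, K.Adj x y) {S T : Set V}
    (h : ∃ u ∈ S, ∃ v ∈ T, G.Adj u v) :
    ∃ x ∈ ⋃ v ∈ S, D v, ∃ y ∈ ⋃ v ∈ T, D v, K.Adj x y := by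
  obtain ⟨u, hu, v, hv, huv⟩ := h
  obtain ⟨x, hx, y, hy, hxy⟩ := hadj u v huv
  exact ⟨x, Set.mem_biUnion hu hx, y, Set.mem_biUnion hv hy, hxy⟩

lemma IsMinor.trans {V W X : Type*} {H : SimpleGraph V} {G : SimpleGraph W} {K : SimpleGraph X}
    (h₁ : IsMinor H G) (h₂ : IsMinor G K) : IsMinor H K := by
  obtain ⟨B, hB, hBd, hBa⟩ := h₁
  obtain ⟨D, hD, hDd, hDa⟩ := h₂
  exact ⟨fun v => ⋃ w ∈ B v, D w, fun v => connected_induce_biUnion hD hDa (hB v),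
    fun u v huv => disjoint_biUnion_of_disjoint hDd (hBd u v huv),
    fun u v huv => exists_adj_biUnion hDa (hBa u v huv)⟩

/-- A countable graph is a minor of every graph with a countably infinite complete minor. -/
lemma IsMinor.of_top_nat {V W : Type*} [Countable V] (G : SimpleGraph V) {K : SimpleGraph W}
    (h : IsMinor (⊤ : SimpleGraph ℕ) K) : IsMinor G K := by
  obtain ⟨D, hD, hDd, hDa⟩ := h
  obtain ⟨f, hf⟩ := exists_injective_nat V
  exact ⟨D ∘ f, fun v => hD _, fun u v huv => hDd _ _ (hf.ne huv),
    fun u v huv => hDa _ _ (hf.ne huv.ne)⟩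

/-- The graph obtained from `U` by adding a new vertex `none` adjacent to all vertices of `U`. -/
def SimpleGraph.cone {W : Type*} (U : SimpleGraph W) : SimpleGraph (Option W) where
  Adj
    | none, none => False
    | some a, some b => U.Adj a b
    | _, _ => True
  symm := ⟨by
    rintro (_ | a) (_ | b) h
    exacts [h, trivial, trivial, U.adj_symm h]⟩
  loopless := ⟨by
    rintro (_ | a) h
    exacts [h, U.loopless.irrefl a h]⟩

lemma SimpleGraph.connected_induce_preimage_some {W : Type*} {U : SimpleGraph W}
    {S : Set (Option W)} (hnone : none ∉ S) (hS : (U.cone.induce S).Connected) :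
    (U.induce (some ⁻¹' S)).Connected := by
  have get (x : S) : ∃ y : W, some y = x.1 :=
    Option.ne_none_iff_exists.1 fun e => hnone (e ▸ x.2)
  choose g hg using get
  let φ : U.cone.induce S →g U.induce (some ⁻¹' S) :=
    { toFun := fun x => ⟨g x, by simp only [Set.mem_preimage, hg]; exact x.2⟩
      map_rel' := by
        intro a b hab
        change U.cone.Adj a.1 b.1 at hab
        rw [← hg, ← hg] at hab
        exact hab }
  refine hS.map (f := φ) ?_
  rintro ⟨w, hw⟩
  exact ⟨⟨some w, hw⟩, Subtype.ext (Option.some_injective _ (hg ⟨some w, hw⟩))⟩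

/-- Deleting a suitable vertex of a minor of the cone over `U` yields a minor of `U`. -/
lemma IsMinor.exists_induce_ne_of_cone {V W : Type*} [Nonempty V] {G : SimpleGraph V}
    {U : SimpleGraph W} (h : IsMinor G U.cone) :
    ∃ v : V, IsMinor (G.induce {u : V | u ≠ v}) U := by
  obtain ⟨B, hB, hBd, hBa⟩ := h
  obtain ⟨v, hv⟩ : ∃ v : V, ∀ u, u ≠ v → none ∉ B u := by
    by_cases h : ∃ v, none ∈ B v
    · obtain ⟨v, hv⟩ := h
      exact ⟨v, fun u huv hu => Set.disjoint_left.1 (hBd u v huv) hu hv⟩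
    · push Not at h
      exact ⟨Classical.arbitrary V, fun u _ => h u⟩
  refine ⟨v, fun u => some ⁻¹' B u,
    fun u => SimpleGraph.connected_induce_preimage_some (hv u u.2) (hB u),
    fun a b hab => (hBd a b (Subtype.coe_injective.ne hab)).preimage _, ?_⟩
  intro a b hab
  obtain ⟨_ | x, hx, _ | y, hy, hxy⟩ := hBa a b hab
  · exact (hv a a.2 hx).elim
  · exact (hv a a.2 hx).elim
  · exact (hv b b.2 hy).elim
  · exact ⟨x, hx, y, hy, hxy⟩

/-- A graph containing the cone over itself as a minor has a countably infinite complete minor. -/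
lemma IsMinor.top_nat_of_cone {W : Type*} {U : SimpleGraph W} (h : IsMinor U.cone U) :
    IsMinor (⊤ : SimpleGraph ℕ) U := by
  obtain ⟨F, hF, hFd, hFa⟩ := h
  let D : W → Set W := fun w => F (some w)
  have hD : ∀ w, (U.induce (D w)).Connected := fun w => hF _
  have hDd : ∀ u v, u ≠ v → Disjoint (D u) (D v) := fun u v huv =>
    hFd _ _ ((Option.some_injective _).ne huv)
  have hDa : ∀ u v, U.Adj u v → ∃ x ∈ D u, ∃ y ∈ D v, U.Adj x y := fun u v huv =>
    hFa (some u) (some v) huv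
  let B : ℕ → Set W := fun n => Nat.rec (F none) (fun _ S => ⋃ w ∈ S, D w) n
  have conn (n : ℕ) : (U.induce (B n)).Connected := by
    induction n with
    | zero => exact hF none
    | succ n ih => exact connected_induce_biUnion hD hDa ih
  have key (m k : ℕ) : Disjoint (B m) (B (m + k + 1)) ∧
      ∃ x ∈ B m, ∃ y ∈ B (m + k + 1), U.Adj x y := by
    induction m with
    | zero =>
      rw [Nat.zero_add]
      constructor
      · change Disjoint (F none) (⋃ w ∈ B k, D w)
        simp only [Set.disjoint_iUnion_right]
        exact fun w _ => hFd none (some w) (Option.some_ne_none w).symm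
      · obtain ⟨w⟩ := (conn k).nonempty
        obtain ⟨x, hx, y, hy, hxy⟩ := hFa none (some w.1) trivial
        exact ⟨x, hx, y, Set.mem_biUnion w.2 hy, hxy⟩
    | succ m ih =>
      rw [show m + 1 + k + 1 = (m + k + 1) + 1 by omega]
      exact ⟨disjoint_biUnion_of_disjoint hDd ih.1, exists_adj_biUnion hDa ih.2⟩
  refine ⟨B, conn, fun m n hmn => ?_, fun m n hmn => ?_⟩
  · rcases hmn.lt_or_gt with h | h <;> obtain ⟨k, rfl⟩ := Nat.exists_eq_add_of_lt h
    · exact (key _ k).1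
    · exact (key _ k).1.symm
  · rcases hmn.ne.lt_or_gt with h | h <;> obtain ⟨k, rfl⟩ := Nat.exists_eq_add_of_lt h
    · exact (key _ k).2
    · obtain ⟨x, hx, y, hy, hxy⟩ := (key _ k).2
      exact ⟨y, hy, x, hx, hxy.symm⟩

/-- Let `G` be a countable graph such that `G` is a minor of `G - v` for every vertex `v`
(here `G - v` is the subgraph induced on the complement of `v`).  Then the class of
countable graphs with no `G` minor has no minor-universal element. -/
theorem no_universal_of_minor_of_vertex_deleted {V : Type} [Countable V]
    (G : SimpleGraph V) (hG : ∀ v : V, IsMinor G (G.induce {u : V | u ≠ v})) :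
    ¬ ∃ (W : Type) (_ : Countable W) (U : SimpleGraph W),
        ¬ IsMinor G U ∧
        ∀ (X : Type) (_ : Countable X) (H : SimpleGraph X),
          ¬ IsMinor G H → IsMinor H U := by
  rintro ⟨W, _, U, hGU, huniv⟩
  have : Nonempty V := by
    by_contra hV
    rw [not_nonempty_iff] at hV
    exact hGU ⟨fun _ => ∅, isEmptyElim, isEmptyElim, isEmptyElim⟩
  refine hGU (.of_top_nat G (.top_nat_of_cone (huniv (Option W) inferInstance U.cone fun h => ?_)))
  obtain ⟨v, hv⟩ := h.exists_induce_ne_of_cone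
  exact hGU ((hG v).trans hv)
end

section
/- The class of countable graphs containing at most one cycle has no minor-universal element: there is no countable graph U containing at most one cycle such that every countable graph containing at most one cycle is a minor of U. -/
/-- `G` contains at most one cycle (as a subgraph): any two cycles of `G` have the same
edge set, i.e. they are the same cycle subgraph. -/
def AtMostOneCycle {V : Type*} (G : SimpleGraph V) : Prop :=
  ∀ (u v : V) (c : G.Walk u u) (d : G.Walk v v), c.IsCycle → d.IsCycle →
    ∀ e : Sym2 V, e ∈ c.edges ↔ e ∈ d.edges

open SimpleGraph

/-- A cycle in the cyclic graph on `ZMod (n + 3)` traverses every edge. -/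
theorem mem_edges_of_isCycle_circulantGraph {n : ℕ} {u : ZMod (n + 3)}
    {c : (circulantGraph ({1} : Set (ZMod (n + 3)))).Walk u u} (hc : c.IsCycle)
    (v : ZMod (n + 3)) : s(v, v + 1) ∈ c.edges := by
  have hnext : ∀ w ∈ c.support, s(w, w + 1) ∈ c.edges := by
    intro w hw
    have hsub : c.toSubgraph.neighborSet w ⊆ {w - 1, w + 1} := by
      intro x hx
      have hadj := c.toSubgraph.adj_sub hx
      simp only [circulantGraph_adj, Set.mem_singleton_iff] at hadj
      grind
    have heq : c.toSubgraph.neighborSet w = {w - 1, w + 1} := by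
      refine Set.eq_of_subset_of_ncard_le hsub ?_ (Set.toFinite _)
      rw [hc.ncard_neighborSet_toSubgraph_eq_two hw]
      exact Set.ncard_insert_le _ _ |>.trans (by simp)
    have hmem : w + 1 ∈ c.toSubgraph.neighborSet w := by simp [heq]
    exact c.adj_toSubgraph_iff_mem_edges.1 hmem
  have hsupp : ∀ k : ℕ, u + k ∈ c.support := by
    intro k
    induction k with
    | zero => simp
    | succ k ih =>
      rw [Nat.cast_succ, ← add_assoc]
      exact c.snd_mem_support_of_mem_edges (hnext _ ih)
  refine hnext v ?_
  simpa using hsupp (v - u).val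

/-- The cyclic graph on `ZMod (n + 3)` contains at most one cycle. -/
theorem atMostOneCycle_circulantGraph (n : ℕ) :
    AtMostOneCycle (circulantGraph ({1} : Set (ZMod (n + 3)))) := by
  have key : ∀ (u : ZMod (n + 3)) (c : (circulantGraph ({1} : Set (ZMod (n + 3)))).Walk u u),
      c.IsCycle → ∀ e, e ∈ c.edges ↔ e ∈ (circulantGraph ({1} : Set (ZMod (n + 3)))).edgeSet := by
    intro u c hc e
    refine ⟨fun h => c.edges_subset_edgeSet h, ?_⟩
    induction e with
    | h x y =>
      intro h
      simp only [mem_edgeSet, circulantGraph_adj, Set.mem_singleton_iff] at h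
      obtain ⟨-, h | h⟩ := h
      · obtain rfl : x = y + 1 := by grind
        rw [Sym2.eq_swap]
        exact mem_edges_of_isCycle_circulantGraph hc y
      · obtain rfl : y = x + 1 := by grind
        exact mem_edges_of_isCycle_circulantGraph hc x
  intro u v c d hc hd e
  rw [key u c hc, key v d hd]

/-- If the cyclic graph on `ZMod (n + 3)` is a minor of `G`, then at least `n + 3` edges of `G`
lie on cycles. -/
theorem exists_injective_mem_cycle_of_isMinor {V : Type*} {G : SimpleGraph V} {n : ℕ}
    (h : IsMinor (circulantGraph ({1} : Set (ZMod (n + 3)))) G) :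
    ∃ f : ZMod (n + 3) → Sym2 V, Function.Injective f ∧
      ∀ i, ∃ (u : V) (c : G.Walk u u), c.IsCycle ∧ f i ∈ c.edges := by
  obtain ⟨B, hconn, hdisj, hedge⟩ := h
  have two_ne : (2 : ZMod (n + 3)) ≠ 0 := by
    intro h2
    have h2' : ((2 : ℕ) : ZMod (n + 3)) = 0 := by exact_mod_cast h2
    rw [ZMod.natCast_eq_zero_iff] at h2'
    have := Nat.le_of_dvd (by norm_num) h2'
    omega
  have one_ne : (1 : ZMod (n + 3)) ≠ 0 := fun h1 => two_ne (by linear_combination 2 * h1)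
  have index_eq : ∀ {i j : ZMod (n + 3)} {x : V}, x ∈ B i → x ∈ B j → i = j := by
    intro i j x hi hj
    by_contra hne
    exact Set.disjoint_left.1 (hdisj i j hne) hi hj
  have hadj : ∀ i : ZMod (n + 3), ∃ x y, x ∈ B i ∧ y ∈ B (i + 1) ∧ G.Adj x y := by
    intro i
    obtain ⟨x, hx, y, hy, hxy⟩ := hedge i (i + 1) (by simp [circulantGraph_adj, one_ne])
    exact ⟨x, y, hx, hy, hxy⟩
  choose a b ha hb hab using hadj
  have hinj : Function.Injective fun i => s(a i, b i) := by
    intro i j hij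
    rcases Sym2.eq_iff.1 hij with ⟨h1, -⟩ | ⟨h1, h2⟩
    · exact index_eq (ha i) (h1 ▸ ha j)
    · have e1 := index_eq (ha i) (h1 ▸ hb j)
      have e2 := index_eq (hb i) (h2 ▸ ha j)
      exact (two_ne (by linear_combination e2 - e1)).elim
  refine ⟨fun i => s(a i, b i), hinj, fun i => ?_⟩
  have hinside : ∀ (j : ZMod (n + 3)) (x y : V), x ∈ B j → y ∈ B j →
      (G \ fromEdgeSet {s(a i, b i)}).Reachable x y := by
    intro j x y hx hy
    let φ : G.induce (B j) →g G \ fromEdgeSet {s(a i, b i)} :=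
      { toFun := Subtype.val
        map_rel' := by
          intro p q hpq
          have hpq' : G.Adj p q := hpq
          refine (sdiff_adj _ _ _ _).2 ⟨hpq', fun hmem => ?_⟩
          have heq : s((p : V), (q : V)) = s(a i, b i) := ((fromEdgeSet_adj _).1 hmem).1
          rcases Sym2.eq_iff.1 heq with ⟨h1, h2⟩ | ⟨h1, h2⟩
          · have e1 := index_eq (ha i) (h1 ▸ p.2)
            have e2 := index_eq (hb i) (h2 ▸ q.2)
            exact one_ne (by linear_combination e2 - e1)
          · have e1 := index_eq (hb i) (h1 ▸ p.2)
            have e2 := index_eq (ha i) (h2 ▸ q.2)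
            exact one_ne (by linear_combination e1 - e2) }
    exact ((hconn j).preconnected ⟨x, hx⟩ ⟨y, hy⟩).map φ
  have haround : ∀ k : ℕ, k < n + 3 → ∀ y ∈ B (i + 1 + k),
      (G \ fromEdgeSet {s(a i, b i)}).Reachable (b i) y := by
    intro k
    induction k with
    | zero => exact fun _ y hy => hinside (i + 1) _ _ (hb i) (by simpa using hy)
    | succ k ih =>
      intro hk y hy
      have hne : i + 1 + k ≠ i := by
        intro h0
        have h0' : ((k + 1 : ℕ) : ZMod (n + 3)) = 0 := by push_cast; linear_combination h0
        rw [ZMod.natCast_eq_zero_iff] at h0'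
        have := Nat.le_of_dvd (by omega) h0'
        omega
      have hstep : (G \ fromEdgeSet {s(a i, b i)}).Adj (a (i + 1 + k)) (b (i + 1 + k)) :=
        (sdiff_adj _ _ _ _).2 ⟨hab _, fun hmem => hne (hinj ((fromEdgeSet_adj _).1 hmem).1)⟩
      refine ((ih (by omega) _ (ha _)).trans hstep.reachable).trans
        (hinside (i + 1 + k + 1) _ _ (hb _) ?_)
      simpa [add_assoc] using hy
  have hlast : a i ∈ B (i + 1 + ((n + 2 : ℕ) : ZMod (n + 3))) := by
    have hzero : ((n + 3 : ℕ) : ZMod (n + 3)) = 0 := ZMod.natCast_self _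
    have hi : i + 1 + ((n + 2 : ℕ) : ZMod (n + 3)) = i := by
      push_cast at hzero ⊢
      linear_combination hzero
    exact hi.symm ▸ ha i
  exact adj_and_reachable_delete_edges_iff_exists_cycle.1
    ⟨hab i, (haround (n + 2) (by omega) _ hlast).symm⟩

/-- The class of countable graphs containing at most one cycle has no minor-universal
element. -/
theorem no_universal_at_most_one_cycle :
    ¬ ∃ (V : Type) (_ : Countable V) (U : SimpleGraph V),
        AtMostOneCycle U ∧
        ∀ (W : Type) (_ : Countable W) (G : SimpleGraph W),
          AtMostOneCycle G → IsMinor G U := by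
  rintro ⟨V, _, U, hU, huniv⟩
  obtain ⟨L, hL⟩ : ∃ L : List (Sym2 V), ∀ (u : V) (c : U.Walk u u), c.IsCycle →
      ∀ e ∈ c.edges, e ∈ L := by
    by_cases hex : ∃ (u : V) (c : U.Walk u u), c.IsCycle
    · obtain ⟨u, c, hc⟩ := hex
      exact ⟨c.edges, fun v d hd e he => (hU u v c d hc hd e).2 he⟩
    · exact ⟨[], fun u c hc => absurd ⟨u, c, hc⟩ hex⟩
  obtain ⟨f, hf, hfc⟩ := exists_injective_mem_cycle_of_isMinor
    (huniv _ inferInstance _ (atMostOneCycle_circulantGraph L.length))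
  classical
  have hcard := Finset.card_le_card_of_injOn (s := Finset.univ) (t := L.toFinset) f
    (fun i _ => by
      obtain ⟨u, c, hc, he⟩ := hfc i
      simpa using hL u c hc _ he) hf.injOn
  rw [Finset.card_univ, ZMod.card] at hcard
  have := L.toFinset_card_le
  omega
end
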